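/- arXiv:2103.09579 — 2 statements merged into one kernel-verified Lean document; each statement's English description precedes it below -/
import Mathlib

section
/- Let 1/2 < H < 1, let b ≥ H − 1/2 with b > 0, and define γ_H(k) = (1/2)|k+1|^{2H} + (1/2)|k−1|^{2H} − |k|^{2H} for k ∈ ℤ. Define a_{nm} = |γ_H(n−m)| · |n|^{−b} |m|^{−b} for integers n ≠ m with n ≠ 0 and m ≠ 0, and a_{nm} = 0 if n = m or n = 0 or m = 0. Then the matrix (a_{nm})_{n,m∈ℤ} defines a bounded operator on ℓ²(ℤ): there exists K > 0 such that for every sequence (x_n)_{n∈ℤ} of nonnegative reals with ∑_{n∈ℤ} x_n² < ∞, ∑_{n∈ℤ} ( ∑_{m∈ℤ} a_{nm} x_m )² ≤ K² ∑_{n∈ℤ} x_n². -/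
/-- The covariance function of fractional Gaussian noise of Hurst index `H`:
`γ_H(k) = (1/2)|k+1|^{2H} + (1/2)|k−1|^{2H} − |k|^{2H}`. -/
noncomputable def gammaH (H : ℝ) (k : ℤ) : ℝ :=
  (1 / 2) * |((k + 1 : ℤ) : ℝ)| ^ (2 * H) + (1 / 2) * |((k - 1 : ℤ) : ℝ)| ^ (2 * H)
    - |(k : ℝ)| ^ (2 * H)

/-- The matrix `a_{nm} = |γ_H(n−m)|·|n|^{−b}|m|^{−b}`, with the convention that
`a_{nm} = 0` whenever `n = m` or one of the indices is `0`. -/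
noncomputable def matG (H b : ℝ) (n m : ℤ) : ℝ :=
  if n = m ∨ n = 0 ∨ m = 0 then 0
  else |gammaH H (n - m)| * |(n : ℝ)| ^ (-b) * |(m : ℝ)| ^ (-b)

theorem aux_step1 (s : ℝ) (h0 : 0 < s) (h1 : s < 1) (k : ℝ) (hk : 0 ≤ k) :
    (k + 1) ^ (-s) ≤ ((k + 1) ^ (1 - s) - k ^ (1 - s)) / (1 - s) := by
  have hk1 : 0 < k + 1 := by linarith
  rw [le_div_iff₀ (by linarith)]
  have hB : (1 + (-(1 / (k + 1)))) ^ (1 - s) ≤ 1 + (1 - s) * (-(1 / (k + 1))) := by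
    apply rpow_one_add_le_one_add_mul_self
    · rw [neg_le_neg_iff, div_le_one hk1]; linarith
    · linarith
    · linarith
  have e1 : (1 + (-(1 / (k + 1)))) = k / (k + 1) := by field_simp; ring
  rw [e1, Real.div_rpow hk hk1.le, div_le_iff₀ (Real.rpow_pos_of_pos hk1 _)] at hB
  have e2 : (k + 1) ^ (1 - s) = (k + 1) * (k + 1) ^ (-s) := by
    rw [sub_eq_add_neg, Real.rpow_add hk1, Real.rpow_one]
  have e3 : (1 + (1 - s) * -(1 / (k + 1))) * ((k + 1) * (k + 1) ^ (-s))
      = (k + 1) * (k + 1) ^ (-s) - (1 - s) * (k + 1) ^ (-s) := by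
    field_simp; ring
  rw [e2, e3] at hB
  rw [e2]
  linarith

theorem aux_step2 (q : ℝ) (h0 : 0 < q) (h1 : q < 1) (k : ℝ) (hk : 0 < k) :
    (k + 1) ^ (-(1 + q)) ≤ (k ^ (-q) - (k + 1) ^ (-q)) / q := by
  have hk1 : 0 < k + 1 := by linarith
  rw [le_div_iff₀ h0]
  have hB : (1 + (-(1 / (k + 1)))) ^ q ≤ 1 + q * (-(1 / (k + 1))) := by
    apply rpow_one_add_le_one_add_mul_self
    · rw [neg_le_neg_iff, div_le_one hk1]; linarith
    · linarith
    · linarith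
  have e1 : (1 + (-(1 / (k + 1)))) = k / (k + 1) := by field_simp; ring
  rw [e1, Real.div_rpow hk.le hk1.le] at hB
  have e2 : (k + 1) ^ (-(1 + q)) = (k + 1) ^ (-q) * (1 / (k + 1)) := by
    rw [show -(1 + q) = -q + -1 by ring, Real.rpow_add hk1, Real.rpow_neg_one, one_div]
  rw [e2, Real.rpow_neg hk.le, Real.rpow_neg hk1.le]
  have ha := Real.rpow_pos_of_pos hk q
  have hc := Real.rpow_pos_of_pos hk1 q
  set a := k ^ q
  set c := (k + 1) ^ q
  have hx : 0 < 1 / (k + 1) := by positivity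
  set x := 1 / (k + 1)
  have hr : 0 < a / c := by positivity
  have key : 1 + q * x ≤ c / a := by
    rw [show c / a = (a / c)⁻¹ by rw [inv_div], le_inv_comm₀ (by positivity) hr]
    refine hB.trans ?_
    rw [le_inv_comm₀ (by nlinarith) (by positivity), ← one_div, le_div_iff₀ (by nlinarith)]
    nlinarith [sq_nonneg (q * x)]
  have : c⁻¹ * (1 + q * x) ≤ c⁻¹ * (c / a) := by gcongr
  have e : c⁻¹ * (c / a) = a⁻¹ := by field_simp
  rw [e] at this
  linarith

theorem aux_sum (s t : ℝ) (hs0 : 0 < s) (hs1 : s < 1) (ht1 : t < 1) (hst : 1 < s + t)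
    (N : ℕ) (hN : 1 ≤ N) (M : ℕ) :
    ∑ j ∈ Finset.range (M + 1), ((j : ℝ) ^ (-s) * (max (N : ℝ) j) ^ (-t)) ≤
      (1 / (1 - s) + 1 / (s + t - 1)) * (N : ℝ) ^ (1 - s - t) := by
  have hNp : (0 : ℝ) < N := by exact_mod_cast hN
  have hsp : 0 < 1 - s := by linarith
  have hqp : 0 < s + t - 1 := by linarith
  have eN : (N : ℝ) ^ (1 - s) * (N : ℝ) ^ (-t) = (N : ℝ) ^ (1 - s - t) := by
    rw [← Real.rpow_add hNp]; ring_nf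
  have h1 : ∀ M : ℕ, M ≤ N →
      ∑ j ∈ Finset.range (M + 1), ((j : ℝ) ^ (-s) * (max (N : ℝ) j) ^ (-t)) ≤
        (M : ℝ) ^ (1 - s) / (1 - s) * (N : ℝ) ^ (-t) := by
    intro M
    induction M with
    | zero =>
      intro _
      simp [Real.zero_rpow (neg_ne_zero.2 hs0.ne'), Real.zero_rpow hsp.ne']
    | succ k ih =>
      intro hk
      rw [Finset.sum_range_succ]
      have := ih (by omega)
      have hm : max (N : ℝ) ((k + 1 : ℕ) : ℝ) = N := max_eq_left (by exact_mod_cast hk)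
      rw [hm]
      have h2 := aux_step1 s hs0 hs1 k (Nat.cast_nonneg k)
      have h3 := mul_le_mul_of_nonneg_right h2 (Real.rpow_nonneg hNp.le (-t))
      push_cast
      rw [sub_div, sub_mul] at h3
      linarith
  have h2 : ∀ d : ℕ,
      ∑ j ∈ Finset.range (N + d + 1), ((j : ℝ) ^ (-s) * (max (N : ℝ) j) ^ (-t)) ≤
        1 / (1 - s) * (N : ℝ) ^ (1 - s - t) + ((N : ℝ) ^ (-(s + t - 1)) -
          ((N + d : ℕ) : ℝ) ^ (-(s + t - 1))) / (s + t - 1) := by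
    intro d
    induction d with
    | zero =>
      have := h1 N le_rfl
      simp only [add_zero, sub_self, zero_div]
      refine this.trans (le_of_eq ?_)
      rw [← eN]; ring
    | succ d ih =>
      rw [show N + (d + 1) + 1 = (N + d + 1) + 1 by ring, Finset.sum_range_succ]
      have hm : max (N : ℝ) ((N + d + 1 : ℕ) : ℝ) = ((N + d + 1 : ℕ) : ℝ) :=
        max_eq_right (by exact_mod_cast (by omega))
      have hpos : (0 : ℝ) < ((N + d + 1 : ℕ) : ℝ) := by positivity
      rw [hm, ← Real.rpow_add hpos]
      have h3 := aux_step2 (s + t - 1) hqp (by linarith) ((N + d : ℕ) : ℝ) (by positivity)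
      have e : -s + -t = -(1 + (s + t - 1)) := by ring
      rw [e]
      have e2 : ((N + d + 1 : ℕ) : ℝ) = ((N + d : ℕ) : ℝ) + 1 := by push_cast; ring
      rw [show N + (d + 1) = N + d + 1 by ring, e2]
      rw [sub_div] at h3 ih ⊢
      linarith
  have hmono : ∑ j ∈ Finset.range (M + 1), ((j : ℝ) ^ (-s) * (max (N : ℝ) j) ^ (-t)) ≤
      ∑ j ∈ Finset.range (N + M + 1), ((j : ℝ) ^ (-s) * (max (N : ℝ) j) ^ (-t)) := by
    apply Finset.sum_le_sum_of_subset_of_nonneg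
    · intro j hj; simp only [Finset.mem_range] at *; omega
    · intro j _ _; positivity
  refine hmono.trans ((h2 M).trans ?_)
  rw [add_mul, show -(s + t - 1) = 1 - s - t by ring]
  gcongr
  rw [div_mul_eq_mul_div, one_mul]
  gcongr
  have : (0 : ℝ) ≤ ((N + M : ℕ) : ℝ) ^ (1 - s - t) := by positivity
  linarith

theorem aux_sumZ (s t : ℝ) (hs0 : 0 < s) (hs1 : s < 1) (ht1 : t < 1) (hst : 1 < s + t)
    (N : ℕ) (hN : 1 ≤ N) (T : Finset ℤ) :
    ∑ k ∈ T, (|(k : ℝ)| ^ (-s) * (max (N : ℝ) |(k : ℝ)|) ^ (-t)) ≤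
      2 * ((1 / (1 - s) + 1 / (s + t - 1)) * (N : ℝ) ^ (1 - s - t)) := by
  obtain ⟨M, hM⟩ : ∃ M : ℕ, T ⊆ Finset.Icc (-(M : ℤ)) M := by
    refine ⟨∑ k ∈ T, k.natAbs, fun k hk => ?_⟩
    have := Finset.single_le_sum (f := fun k : ℤ => k.natAbs) (fun _ _ => Nat.zero_le _) hk
    rw [Finset.mem_Icc]
    omega
  refine (Finset.sum_le_sum_of_subset_of_nonneg hM (fun _ _ _ => by positivity)).trans ?_
  rw [Finset.sum_Icc_of_even_eq_range (f := fun k : ℤ => (|(k : ℝ)| ^ (-s) * (max (N : ℝ) |(k : ℝ)|) ^ (-t)))]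
  · have := aux_sum s t hs0 hs1 ht1 hst N hN M
    simp [Real.zero_rpow (neg_ne_zero.2 hs0.ne')] at this ⊢
    linarith
  · intro k; simp

theorem aux_gamma (H : ℝ) (hH0 : 1 / 2 < H) (hH1 : H < 1) (k : ℤ) (hk : k ≠ 0) :
    |gammaH H k| ≤ |(k : ℝ)| ^ (-(2 - 2 * H)) := by
  have key : ∀ y : ℝ, 1 ≤ y →
      |(1 / 2) * (y + 1) ^ (2 * H) + (1 / 2) * (y - 1) ^ (2 * H) - y ^ (2 * H)|
        ≤ y ^ (-(2 - 2 * H)) := by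
    intro y hy
    have hy0 : 0 < y := by linarith
    have hx1 : 1 / y ≤ 1 := by rw [div_le_one hy0]; exact hy
    have hx0 : 0 < 1 / y := by positivity
    have ey : y * (1 / y) = 1 := by field_simp
    set x := 1 / y
    have e1 : (y + 1) ^ (2 * H) = y ^ (2 * H) * (1 + x) ^ (2 * H) := by
      rw [← Real.mul_rpow hy0.le (by linarith)]; congr 1; linarith
    have e2 : (y - 1) ^ (2 * H) = y ^ (2 * H) * (1 + -x) ^ (2 * H) := by
      rw [← Real.mul_rpow hy0.le (by linarith)]; congr 1; linarith
    have l1 : 1 + 2 * H * x ≤ (1 + x) ^ (2 * H) :=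
      one_add_mul_self_le_rpow_one_add (by linarith) (by linarith)
    have l2 : 1 + 2 * H * (-x) ≤ (1 + -x) ^ (2 * H) :=
      one_add_mul_self_le_rpow_one_add (by linarith) (by linarith)
    have u : ∀ z : ℝ, -1 ≤ z → (1 + z) ^ (2 * H) ≤ (1 + z) * (1 + (2 * H - 1) * z) := by
      intro z hz
      have h := rpow_one_add_le_one_add_mul_self hz (p := 2 * H - 1) (by linarith) (by linarith)
      have e : (1 + z) ^ (2 * H) = (1 + z) * (1 + z) ^ (2 * H - 1) := by
        rw [show 2 * H = 1 + (2 * H - 1) by ring, Real.rpow_add' (by linarith) (by linarith),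
          Real.rpow_one]
        ring_nf
      rw [e]
      exact mul_le_mul_of_nonneg_left h (by linarith)
    have u1 := u x (by linarith)
    have u2 := u (-x) (by linarith)
    have e3 : y ^ (-(2 - 2 * H)) = y ^ (2 * H) * x ^ 2 := by
      rw [show -(2 - 2 * H) = 2 * H + (-2 : ℝ) by ring, Real.rpow_add hy0, Real.rpow_neg hy0.le,
        Real.rpow_two]
      simp [x]
    rw [e1, e2, e3]
    have hP : 0 < y ^ (2 * H) := by positivity
    set P := y ^ (2 * H)
    have e4 : (1 / 2) * (P * (1 + x) ^ (2 * H)) + (1 / 2) * (P * (1 + -x) ^ (2 * H)) - P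
      = P * ((1 / 2) * ((1 + x) ^ (2 * H) + (1 + -x) ^ (2 * H) - 2)) := by ring
    rw [e4, abs_mul, abs_of_pos hP, abs_of_nonneg (by linarith)]
    gcongr
    nlinarith [sq_nonneg x]
  unfold gammaH
  rcases lt_or_gt_of_ne hk with h | h
  · have h1 : (k : ℝ) ≤ -1 := by exact_mod_cast (by omega : k ≤ -1)
    have := key (-k) (by linarith)
    push_cast
    rw [abs_of_nonpos (show (k : ℝ) + 1 ≤ 0 by linarith),
      abs_of_nonpos (show (k : ℝ) - 1 ≤ 0 by linarith),
      abs_of_nonpos (show (k : ℝ) ≤ 0 by linarith)]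
    convert this using 2
    rw [show -((k : ℝ) + 1) = -k - 1 by ring, show -((k : ℝ) - 1) = -k + 1 by ring]
    ring
  · have h1 : (1 : ℝ) ≤ k := by exact_mod_cast (by omega : 1 ≤ k)
    have := key k h1
    push_cast
    rwa [abs_of_nonneg (show 0 ≤ (k : ℝ) + 1 by linarith),
      abs_of_nonneg (show 0 ≤ (k : ℝ) - 1 by linarith),
      abs_of_nonneg (show 0 ≤ (k : ℝ) by linarith)]

theorem aux_schur (A : ℤ → ℤ → ℝ) (hA : ∀ n m, 0 ≤ A n m) (hsym : ∀ n m, A n m = A m n)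
    (w : ℤ → ℝ) (hw : ∀ n, 0 < w n) (C : ℝ) (hC : 0 < C)
    (hrow : ∀ n (T : Finset ℤ), ∑ m ∈ T, A n m * w m ≤ C * w n)
    (x : ℤ → ℝ) (hx : ∀ n, 0 ≤ x n) (hxs : Summable (fun n => x n ^ 2)) :
    (∀ n : ℤ, Summable (fun m : ℤ => A n m * x m)) ∧
      (∑' n : ℤ, (∑' m : ℤ, A n m * x m) ^ 2) ≤ C ^ 2 * ∑' n : ℤ, x n ^ 2 := by
  have hfin : ∀ S T : Finset ℤ, ∑ n ∈ S, (∑ m ∈ T, A n m * x m) ^ 2 ≤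
      C ^ 2 * ∑' n : ℤ, x n ^ 2 := by
    intro S T
    have h1 : ∀ n ∈ S, (∑ m ∈ T, A n m * x m) ^ 2 ≤
        ∑ m ∈ T, C * w n * (A n m * (x m ^ 2 / w m)) := by
      intro n _
      have hcs := Finset.sum_sq_le_sum_mul_sum_of_sq_le_mul T
        (r := fun m => A n m * x m) (f := fun m => A n m * w m)
        (g := fun m => A n m * (x m ^ 2 / w m))
        (fun m _ => mul_nonneg (hA n m) (hw m).le)
        (fun m _ => mul_nonneg (hA n m) (div_nonneg (sq_nonneg _) (hw m).le))
        (fun m _ => le_of_eq (by have := (hw m).ne'; field_simp))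
      refine hcs.trans ?_
      rw [← Finset.mul_sum]
      exact mul_le_mul_of_nonneg_right (hrow n T)
        (Finset.sum_nonneg fun m _ => mul_nonneg (hA n m) (div_nonneg (sq_nonneg _) (hw m).le))
    refine (Finset.sum_le_sum h1).trans ?_
    rw [Finset.sum_comm]
    have h2 : ∀ m ∈ T, ∑ n ∈ S, C * w n * (A n m * (x m ^ 2 / w m)) ≤ C ^ 2 * x m ^ 2 := by
      intro m _
      have e : ∑ n ∈ S, C * w n * (A n m * (x m ^ 2 / w m))
          = (C * (x m ^ 2 / w m)) * ∑ n ∈ S, A m n * w n := by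
        rw [Finset.mul_sum]
        refine Finset.sum_congr rfl fun n _ => ?_
        rw [hsym n m]; ring
      rw [e]
      refine (mul_le_mul_of_nonneg_left (hrow m S)
        (mul_nonneg hC.le (div_nonneg (sq_nonneg _) (hw m).le))).trans (le_of_eq ?_)
      have := (hw m).ne'
      field_simp
    refine (Finset.sum_le_sum h2).trans ?_
    rw [← Finset.mul_sum]
    exact mul_le_mul_of_nonneg_left (hxs.sum_le_tsum T (fun _ _ => sq_nonneg _)) (sq_nonneg C)
  have hsum : ∀ n : ℤ, Summable (fun m : ℤ => A n m * x m) := by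
    intro n
    refine summable_of_sum_le (c := √(C ^ 2 * ∑' n : ℤ, x n ^ 2))
      (fun m => mul_nonneg (hA n m) (hx m)) fun T => ?_
    apply Real.le_sqrt_of_sq_le
    simpa using hfin {n} T
  refine ⟨hsum, ?_⟩
  refine Real.tsum_le_of_sum_le (fun n => sq_nonneg _) fun S => ?_
  have ht : Filter.Tendsto (fun T : Finset ℤ => ∑ n ∈ S, (∑ m ∈ T, A n m * x m) ^ 2)
      Filter.atTop (nhds (∑ n ∈ S, (∑' m : ℤ, A n m * x m) ^ 2)) :=
    tendsto_finsetSum S fun n _ => ((hsum n).hasSum.pow 2)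
  exact le_of_tendsto' ht (fun T => hfin S T)

theorem aux_term (s t : ℝ) (hs0 : 0 < s) (ht0 : 0 < t) (n m : ℤ) (hm : m ≠ 0) (hnm : n ≠ m)
    (hn : n ≠ 0) :
    |((n - m : ℤ) : ℝ)| ^ (-t) * |(m : ℝ)| ^ (-s) ≤
      2 ^ t * (|(m : ℝ)| ^ (-s) * (max (n.natAbs : ℝ) |(m : ℝ)|) ^ (-t)) +
      2 ^ s * (|((n - m : ℤ) : ℝ)| ^ (-t) *
        (max (n.natAbs : ℝ) |((n - m : ℤ) : ℝ)|) ^ (-s)) := by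
  have hd : 0 < |((n - m : ℤ) : ℝ)| := by
    rw [abs_pos]; exact_mod_cast sub_ne_zero.2 hnm
  have hmp : 0 < |(m : ℝ)| := by rw [abs_pos]; exact_mod_cast hm
  have htri : (n.natAbs : ℝ) ≤ |((n - m : ℤ) : ℝ)| + |(m : ℝ)| := by
    rw [Nat.cast_natAbs, Int.cast_abs]
    have := abs_add_le ((n - m : ℤ) : ℝ) (m : ℝ)
    push_cast at *
    simpa using this
  set d := |((n - m : ℤ) : ℝ)|
  set a := |(m : ℝ)|
  set N := (n.natAbs : ℝ)
  have gen : ∀ (u c r : ℝ), 0 < c → 0 < r → 0 < u → u ≤ 2 * c → c ^ (-r) ≤ 2 ^ r * u ^ (-r) := by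
    intro u c r hc hr hu h
    have h2 : (2 : ℝ) ^ r * u ^ (-r) = (u / 2) ^ (-r) := by
      rw [Real.div_rpow hu.le (by norm_num), Real.rpow_neg (x := 2) (by norm_num)]
      field_simp
    rw [h2]
    exact Real.rpow_le_rpow_of_nonpos (by positivity) (by linarith) (by linarith)
  rcases le_total a d with h | h
  · have h1 := gen (max N a) d t hd ht0 (lt_max_of_lt_right hmp) (max_le (by linarith) (by linarith))
    have h2 := mul_le_mul_of_nonneg_right h1 (Real.rpow_nonneg hmp.le (-s))
    have h3 : 0 ≤ 2 ^ s * (d ^ (-t) * (max N d) ^ (-s)) := by positivity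
    linarith
  · have h1 := gen (max N d) a s hmp hs0 (lt_max_of_lt_right hd) (max_le (by linarith) (by linarith))
    have h2 := mul_le_mul_of_nonneg_left h1 (Real.rpow_nonneg hd.le (-t))
    have h3 : 0 ≤ 2 ^ t * (a ^ (-s) * (max N a) ^ (-t)) := by positivity
    linarith

/-- For `1/2 < H < 1` and `b ≥ H − 1/2`, `b > 0`, the matrix
`(|γ_H(n−m)| |n|^{−b}|m|^{−b})` defines a bounded operator on `ℓ²(ℤ)`: there is
`K > 0` such that for every nonnegative square-summable sequence `(x_n)`,
`∑_n (∑_m a_{nm} x_m)² ≤ K² ∑_n x_n²`. -/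
theorem stmt12 (H b : ℝ) (hH0 : 1 / 2 < H) (hH1 : H < 1)
    (hb : H - 1 / 2 ≤ b) (hb0 : 0 < b) :
    ∃ K > 0, ∀ x : ℤ → ℝ, (∀ n, 0 ≤ x n) → Summable (fun n => x n ^ 2) →
      (∀ n : ℤ, Summable (fun m : ℤ => matG H b n m * x m)) ∧
      (∑' n : ℤ, (∑' m : ℤ, matG H b n m * x m) ^ 2) ≤ K ^ 2 * ∑' n : ℤ, x n ^ 2 := by
  -- exponents: s = H, t = 2 - 2H
  have ht0 : 0 < 2 - 2 * H := by linarith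
  obtain ⟨t, ht⟩ : ∃ t, t = 2 - 2 * H := ⟨_, rfl⟩
  have hd1 : 0 < 1 - H := by linarith
  have hd2 : 0 < H + t - 1 := by linarith
  have hd3 : 0 < 1 - t := by linarith
  have hd4 : 0 < t + H - 1 := by linarith
  set C : ℝ := 2 ^ t * (2 * (1 / (1 - H) + 1 / (H + t - 1))) +
    2 ^ H * (2 * (1 / (1 - t) + 1 / (t + H - 1))) with hCdef
  have hC : 0 < C := by positivity
  have hAnn : ∀ n m, 0 ≤ matG H b n m := by
    intro n m; unfold matG; split_ifs <;> positivity
  have hsym : ∀ n m, matG H b n m = matG H b m n := by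
    intro n m
    have hg : gammaH H (n - m) = gammaH H (m - n) := by
      unfold gammaH
      push_cast
      rw [abs_sub_comm (n : ℝ) m, show (n : ℝ) - m + 1 = -((m : ℝ) - n - 1) by ring,
        show (n : ℝ) - m - 1 = -((m : ℝ) - n + 1) by ring, abs_neg, abs_neg]
      ring
    unfold matG
    by_cases h : n = m ∨ n = 0 ∨ m = 0
    · rw [if_pos h, if_pos (by tauto)]
    · rw [if_neg h, if_neg (by tauto), hg]; ring
  set w : ℤ → ℝ := fun n => if n = 0 then 1 else |(n : ℝ)| ^ (-(1 / 2) : ℝ) with hwdef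
  have hw : ∀ n, 0 < w n := by
    intro n
    simp only [hwdef]
    split_ifs with h
    · norm_num
    · have : 0 < |(n : ℝ)| := by rw [abs_pos]; exact_mod_cast h
      positivity
  refine ⟨C, hC, fun x hx hxs => aux_schur _ hAnn hsym w hw C hC ?_ x hx hxs⟩
  intro n T
  by_cases hn : n = 0
  · have : ∀ m ∈ T, matG H b n m * w m = 0 := by
      intro m _; simp [matG, hn]
    rw [Finset.sum_eq_zero this]
    exact mul_nonneg hC.le (hw n).le
  have hN1 : 1 ≤ n.natAbs := Int.natAbs_pos.2 hn
  have hNabs : (n.natAbs : ℝ) = |(n : ℝ)| := by rw [Nat.cast_natAbs, Int.cast_abs]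
  have hnp : 0 < |(n : ℝ)| := by rw [abs_pos]; exact_mod_cast hn
  have hge1 : ∀ m : ℤ, m ≠ 0 → 1 ≤ |(m : ℝ)| := by
    intro m hm; exact_mod_cast Int.one_le_abs hm
  set f : ℤ → ℝ := fun m => |(m : ℝ)| ^ (-H) * (max (n.natAbs : ℝ) |(m : ℝ)|) ^ (-t) with hf
  set g : ℤ → ℝ := fun m => |(m : ℝ)| ^ (-t) * (max (n.natAbs : ℝ) |(m : ℝ)|) ^ (-H) with hg
  have hterm : ∀ m ∈ T, matG H b n m * w m ≤
      |(n : ℝ)| ^ (-(H - 1 / 2)) * (2 ^ t * f m + 2 ^ H * g (n - m)) := by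
    intro m _
    by_cases h : n = m ∨ n = 0 ∨ m = 0
    · have : matG H b n m = 0 := if_pos h
      rw [this, zero_mul]
      simp only [hf, hg]
      positivity
    · have e : matG H b n m = |gammaH H (n - m)| * |(n : ℝ)| ^ (-b) * |(m : ℝ)| ^ (-b) := if_neg h
      push Not at h
      obtain ⟨hnm, -, hm⟩ := h
      have hmp : 0 < |(m : ℝ)| := by rw [abs_pos]; exact_mod_cast hm
      have ew : w m = |(m : ℝ)| ^ (-(1 / 2) : ℝ) := if_neg hm
      have h1 := aux_gamma H hH0 hH1 (n - m) (sub_ne_zero.2 hnm)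
      rw [← ht] at h1
      have h2 : |(n : ℝ)| ^ (-b) ≤ |(n : ℝ)| ^ (-(H - 1 / 2)) :=
        Real.rpow_le_rpow_of_exponent_le (hge1 n hn) (by linarith)
      have h3 : |(m : ℝ)| ^ (-b) ≤ |(m : ℝ)| ^ (-(H - 1 / 2)) :=
        Real.rpow_le_rpow_of_exponent_le (hge1 m hm) (by linarith)
      have h4 := aux_term H t (by linarith) (by linarith) n m hm hnm hn
      have h5 : |(m : ℝ)| ^ (-(H - 1 / 2)) * |(m : ℝ)| ^ (-(1 / 2) : ℝ) = |(m : ℝ)| ^ (-H) := by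
        rw [← Real.rpow_add hmp]; ring_nf
      calc matG H b n m * w m
          = |gammaH H (n - m)| * |(n : ℝ)| ^ (-b) * |(m : ℝ)| ^ (-b)
              * |(m : ℝ)| ^ (-(1 / 2) : ℝ) := by rw [e, ew]
        _ ≤ |((n - m : ℤ) : ℝ)| ^ (-t) * |(n : ℝ)| ^ (-(H - 1 / 2))
              * |(m : ℝ)| ^ (-(H - 1 / 2)) * |(m : ℝ)| ^ (-(1 / 2) : ℝ) := by gcongr
        _ = |(n : ℝ)| ^ (-(H - 1 / 2)) * (|((n - m : ℤ) : ℝ)| ^ (-t) * |(m : ℝ)| ^ (-H)) := by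
              rw [← h5]; ring
        _ ≤ _ := by
              refine mul_le_mul_of_nonneg_left h4 (by positivity)
  refine (Finset.sum_le_sum hterm).trans ?_
  rw [← Finset.mul_sum, Finset.sum_add_distrib, ← Finset.mul_sum, ← Finset.mul_sum]
  have s1 := aux_sumZ H t (by linarith) hH1 (by linarith) (by linarith) n.natAbs hN1 T
  have s2 := aux_sumZ t H (by linarith) (by linarith) hH1 (by linarith) n.natAbs hN1
    (T.image (fun m => n - m))
  rw [Finset.sum_image (fun a _ c _ h => by simpa using h)] at s2
  have e1 : (n.natAbs : ℝ) ^ (1 - t - H) = (n.natAbs : ℝ) ^ (1 - H - t) := by ring_nf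
  rw [e1] at s2
  have ew : w n = |(n : ℝ)| ^ (-(H - 1 / 2)) * (n.natAbs : ℝ) ^ (1 - H - t) := by
    rw [hNabs, ← Real.rpow_add hnp]
    simp only [hwdef, if_neg hn]
    congr 1; rw [ht]; ring
  rw [ew]
  have p1 : (0 : ℝ) ≤ 2 ^ t := by positivity
  have p2 : (0 : ℝ) ≤ 2 ^ H := by positivity
  have q1 := mul_le_mul_of_nonneg_left s1 p1
  have q2 := mul_le_mul_of_nonneg_left s2 p2
  have := mul_le_mul_of_nonneg_left (add_le_add q1 q2)
    (show 0 ≤ |(n : ℝ)| ^ (-(H - 1 / 2)) by positivity)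
  refine this.trans (le_of_eq ?_)
  rw [hCdef]; ring
end

section
/- Let 0 < H < 1 and define γ_H(k) = (1/2)|k+1|^{2H} + (1/2)|k−1|^{2H} − |k|^{2H} for k ∈ ℤ, and ψ_H(t) = 4 sin²(πt) · ( ∑_{n=0}^∞ (n+t)^{-(2H+1)} + ∑_{n=0}^∞ (n+1−t)^{-(2H+1)} ) for t ∈ (0,1). Then ψ_H is integrable on (0,1) and there exists a constant C(H) > 0 such that for every k ∈ ℤ: γ_H(k) = C(H) · ∫_0^1 e^{2πikt} ψ_H(t) dt. In other words, up to the normalization C(H), ψ_H is the spectral density of fractional Gaussian noise of Hurst index H. -/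
open MeasureTheory

/-- The spectral density (up to a normalizing constant) of fractional Gaussian noise of
Hurst index `H`, defined for `t ∈ (0,1)`:
`ψ_H(t) = 4 sin²(πt)·(∑_{n≥0} (n+t)^{-(2H+1)} + ∑_{n≥0} (n+1−t)^{-(2H+1)})`. -/
noncomputable def psi (H t : ℝ) : ℝ :=
  4 * Real.sin (Real.pi * t) ^ 2 *
    ((∑' n : ℕ, ((n : ℝ) + t) ^ (-(2 * H + 1))) +
      ∑' n : ℕ, ((n : ℝ) + 1 - t) ^ (-(2 * H + 1)))

lemma unfold_pos (g : ℝ → ℂ) (hg : IntegrableOn g (Set.Ioi 0)) :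
    ∫ t in Set.Ioo (0:ℝ) 1, ∑' n : ℕ, g ((n:ℝ) + t) = ∫ x in Set.Ioi (0:ℝ), g x := by
  have hU : (⋃ n : ℕ, Set.Ioc (n:ℝ) (n+1)) = Set.Ioi 0 := by
    ext x
    simp only [Set.mem_iUnion, Set.mem_Ioc, Set.mem_Ioi]
    constructor
    · rintro ⟨n, h1, h2⟩
      exact lt_of_le_of_lt (Nat.cast_nonneg n) h1
    · intro hx
      have h0 : 0 < ⌈x⌉₊ := Nat.ceil_pos.mpr hx
      refine ⟨⌈x⌉₊ - 1, ?_, ?_⟩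
      · exact Nat.lt_ceil.mp (by omega)
      · have := Nat.le_ceil x
        have h2 : ((⌈x⌉₊ - 1 : ℕ) : ℝ) + 1 = ⌈x⌉₊ := by
          exact_mod_cast Nat.sub_add_cancel h0
        rw [h2]; exact this
  have hD : Pairwise (Function.onFun Disjoint (fun n : ℕ => Set.Ioc (n:ℝ) (n+1))) := by
    intro m n hmn
    have := Set.pairwise_disjoint_Ioc_intCast ℝ (i := (m:ℤ)) (j := (n:ℤ)) (by exact_mod_cast hmn)
    simpa [Function.onFun] using this
  have shift : ∀ (E : Type) [NormedAddCommGroup E] [NormedSpace ℝ E] (f : ℝ → E) (n : ℕ),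
      ∫ t in Set.Ioo (0:ℝ) 1, f ((n:ℝ) + t) = ∫ x in Set.Ioc (n:ℝ) (n+1), f x := by
    intro E _ _ f n
    rw [← integral_Ioc_eq_integral_Ioo, ← intervalIntegral.integral_of_le zero_le_one,
      ← intervalIntegral.integral_of_le (by linarith), intervalIntegral.integral_comp_add_left]
    simp
  have hs := hasSum_integral_iUnion (μ := volume) (f := g) (s := fun n : ℕ => Set.Ioc (n:ℝ) (n+1))
    (fun i => measurableSet_Ioc) hD (by rw [hU]; exact hg)
  have hsn := hasSum_integral_iUnion (μ := volume) (f := fun x => ‖g x‖)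
    (s := fun n : ℕ => Set.Ioc (n:ℝ) (n+1))
    (fun i => measurableSet_Ioc) hD (by rw [hU]; exact hg.norm)
  rw [hU] at hs
  have h2 := hasSum_integral_of_summable_integral_norm (μ := volume.restrict (Set.Ioo (0:ℝ) 1))
    (F := fun (n : ℕ) t => g ((n:ℝ) + t)) ?_ ?_
  · simp only [shift] at h2
    exact h2.unique hs
  · intro n
    have h3 : IntegrableOn g (Set.Ioc (n:ℝ) (n+1)) := by
      apply hg.mono_set
      rw [← hU]
      exact Set.subset_iUnion (fun n : ℕ => Set.Ioc (n:ℝ) (n+1)) n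
    have h4 : IntervalIntegrable g volume n (n+1) :=
      (intervalIntegrable_iff_integrableOn_Ioc_of_le (by linarith)).2 h3
    have h5 := h4.comp_add_left (n:ℝ)
    simp only [sub_self, add_sub_cancel_left] at h5
    exact ((intervalIntegrable_iff_integrableOn_Ioc_of_le zero_le_one).1 h5).mono_set
      Set.Ioo_subset_Ioc_self
  · have := shift ℝ (fun x => ‖g x‖)
    simp only [this]
    exact hsn.summable

noncomputable def jH (H c x : ℝ) : ℝ := (1 - Real.cos (2 * Real.pi * c * x)) * x ^ (-(2*H+1))

lemma jH_integrable (H c : ℝ) (hH0 : 0 < H) (hH1 : H < 1) :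
    IntegrableOn (jH H c) (Set.Ioi 0) := by
  have hm : Measurable (jH H c) := by
    unfold jH; fun_prop
  rw [← Set.Ioc_union_Ioi_eq_Ioi (zero_le_one : (0:ℝ) ≤ 1)]
  refine IntegrableOn.union ?_ ?_
  · have h1 : IntegrableOn (fun x : ℝ => ((2 * Real.pi * c)^2/2) * x ^ (1 - 2*H)) (Set.Ioc 0 1) := by
      have := (intervalIntegral.intervalIntegrable_rpow' (a := 0) (b := 1) (r := 1 - 2*H)
        (by linarith))
      exact ((intervalIntegrable_iff_integrableOn_Ioc_of_le zero_le_one).1 this).const_mul _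
    refine Integrable.mono' h1 hm.aestronglyMeasurable ?_
    refine (ae_restrict_iff' measurableSet_Ioc).2 (Filter.Eventually.of_forall ?_)
    intro x hx
    have hx0 := hx.1
    have hc := Real.one_sub_sq_div_two_le_cos (x := 2 * Real.pi * c * x)
    have hc1 := Real.cos_le_one (2 * Real.pi * c * x)
    have hp : 0 < x ^ (-(2*H+1)) := Real.rpow_pos_of_pos hx0 _
    have e : x ^ (1 - 2*H) = x^2 * x ^ (-(2*H+1)) := by
      rw [← Real.rpow_natCast, ← Real.rpow_add hx0]; congr 1; push_cast; ring
    unfold jH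
    rw [Real.norm_of_nonneg (mul_nonneg (by linarith) hp.le), e, ← mul_assoc]
    apply mul_le_mul_of_nonneg_right _ hp.le
    nlinarith
  · have h1 : IntegrableOn (fun x : ℝ => 2 * x ^ (-(2*H+1))) (Set.Ioi 1) :=
      (integrableOn_Ioi_rpow_of_lt (by linarith) one_pos).const_mul _
    refine Integrable.mono' h1 hm.aestronglyMeasurable ?_
    refine (ae_restrict_iff' measurableSet_Ioi).2 (Filter.Eventually.of_forall ?_)
    intro x hx
    have hx0 : 0 < x := lt_trans one_pos hx
    have hc := Real.neg_one_le_cos (2 * Real.pi * c * x)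
    have hc1 := Real.cos_le_one (2 * Real.pi * c * x)
    have hp : 0 < x ^ (-(2*H+1)) := Real.rpow_pos_of_pos hx0 _
    unfold jH
    rw [Real.norm_of_nonneg (mul_nonneg (by linarith) hp.le)]
    apply mul_le_mul_of_nonneg_right _ hp.le
    linarith

lemma jH_scale (H c : ℝ) (hH0 : 0 < H) :
    ∫ x in Set.Ioi (0:ℝ), jH H c x = |c| ^ (2*H) * ∫ x in Set.Ioi (0:ℝ), jH H 1 x := by
  have habs : jH H c = jH H |c| := by
    funext x
    unfold jH
    rcases abs_choice c with h | h <;> rw [h]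
    rw [show 2 * Real.pi * -c * x = -(2 * Real.pi * c * x) by ring, Real.cos_neg]
  rw [habs]
  rcases (abs_nonneg c).eq_or_lt with h | h
  · rw [← h, Real.zero_rpow (by positivity)]
    simp [jH]
  · generalize |c| = d at h
    have h1 := integral_comp_mul_left_Ioi (jH H 1) 0 h
    have h2 : ∫ x in Set.Ioi (0:ℝ), jH H 1 (d * x)
        = ∫ x in Set.Ioi (0:ℝ), d ^ (-(2*H+1)) * jH H d x := by
      refine setIntegral_congr_fun measurableSet_Ioi ?_
      intro x hx
      simp only [jH]
      rw [Real.mul_rpow h.le (le_of_lt hx), show 2 * Real.pi * 1 * (d*x) = 2 * Real.pi * d * x by ring]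
      ring
    rw [h2, integral_const_mul, mul_zero, smul_eq_mul] at h1
    have e : d ^ (-(2*H+1)) * (d ^ (2*H) * d) = 1 := by
      nth_rewrite 3 [← Real.rpow_one d]
      rw [← Real.rpow_add h, ← Real.rpow_add h]; simp
    have hd : d * d⁻¹ = 1 := mul_inv_cancel₀ h.ne'
    calc _ = (d ^ (-(2*H+1)) * (d ^ (2*H) * d)) * ∫ x in Set.Ioi (0:ℝ), jH H d x := by
            rw [e, one_mul]
      _ = (d ^ (2*H) * d) * (d ^ (-(2*H+1)) * ∫ x in Set.Ioi (0:ℝ), jH H d x) := by ring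
      _ = d ^ (2*H) * (d * d⁻¹) * ∫ x in Set.Ioi (0:ℝ), jH H 1 x := by rw [h1]; ring
      _ = _ := by rw [hd, mul_one]

lemma jH_pos (H : ℝ) (hH0 : 0 < H) (hH1 : H < 1) :
    0 < ∫ x in Set.Ioi (0:ℝ), jH H 1 x := by
  rw [setIntegral_pos_iff_support_of_nonneg_ae _ (jH_integrable H 1 hH0 hH1)]
  · have : Set.Ioo (0:ℝ) 1 ⊆ Function.support (jH H 1) ∩ Set.Ioi 0 := by
      intro x hx
      refine ⟨?_, hx.1⟩
      have hp : 0 < x ^ (-(2*H+1)) := Real.rpow_pos_of_pos hx.1 _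
      have hs : 0 < Real.sin (Real.pi * x) :=
        Real.sin_pos_of_pos_of_lt_pi (by have := hx.1; positivity)
          (by nlinarith [hx.2, Real.pi_pos])
      have : Real.cos (2 * Real.pi * 1 * x) = 1 - 2 * Real.sin (Real.pi * x)^2 := by
        rw [show 2 * Real.pi * 1 * x = 2 * (Real.pi * x) by ring, Real.cos_two_mul,
          Real.cos_sq']; ring
      simp only [Function.mem_support, jH, this]
      have : 0 < 2 * Real.sin (Real.pi * x)^2 := by positivity
      exact (mul_pos (by linarith) hp).ne'
    refine lt_of_lt_of_le ?_ (measure_mono this)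
    simp
  · refine (ae_restrict_iff' measurableSet_Ioi).2 (Filter.Eventually.of_forall ?_)
    intro x hx
    have hp : 0 < x ^ (-(2*H+1)) := Real.rpow_pos_of_pos hx _
    have hc1 := Real.cos_le_one (2 * Real.pi * 1 * x)
    exact mul_nonneg (by linarith) hp.le

/-- half of psi -/
noncomputable def sH (H t : ℝ) : ℝ :=
  4 * Real.sin (Real.pi * t) ^ 2 * ∑' n : ℕ, ((n : ℝ) + t) ^ (-(2 * H + 1))

lemma psi_eq (H t : ℝ) : psi H t = sH H t + sH H (1 - t) := by
  unfold psi sH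
  have : Real.sin (Real.pi * (1 - t)) = Real.sin (Real.pi * t) := by
    rw [mul_sub, mul_one, Real.sin_pi_sub]
  rw [this]
  simp only [add_sub_assoc]
  ring

noncomputable def eK (k : ℤ) (x : ℝ) : ℂ := Complex.exp (2 * Real.pi * (k : ℝ) * x * Complex.I)

lemma eK_add_nat (k : ℤ) (n : ℕ) (x : ℝ) : eK k (n + x) = eK k x := by
  unfold eK
  rw [Complex.exp_eq_exp_iff_exists_int]
  exact ⟨k * n, by push_cast; ring⟩

lemma eK_sub (k : ℤ) (x : ℝ) : eK k (1 - x) = eK (-k) x := by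
  unfold eK
  rw [Complex.exp_eq_exp_iff_exists_int]
  exact ⟨k, by push_cast; ring⟩

lemma eK_norm (k : ℤ) (x : ℝ) : ‖eK k x‖ = 1 := by
  unfold eK
  have := Complex.norm_exp_ofReal_mul_I (2 * Real.pi * k * x)
  push_cast at this ⊢
  exact this

lemma eK_cont (k : ℤ) : Continuous (eK k) := by
  unfold eK; fun_prop

lemma sin_eq (x : ℝ) : 4 * Real.sin (Real.pi * x)^2 = 2 * (1 - Real.cos (2 * Real.pi * 1 * x)) := by
  rw [show 2 * Real.pi * 1 * x = 2 * (Real.pi * x) by ring, Real.cos_two_mul, Real.cos_sq']; ring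

lemma sin_add_nat (n : ℕ) (t : ℝ) :
    Real.sin (Real.pi * (n + t))^2 = Real.sin (Real.pi * t)^2 := by
  have h1 := sin_eq (n + t)
  have h2 := sin_eq t
  have : Real.cos (2 * Real.pi * 1 * (n + t)) = Real.cos (2 * Real.pi * 1 * t) := by
    rw [show 2 * Real.pi * 1 * (n + t) = 2 * Real.pi * 1 * t + n * (2 * Real.pi) by ring,
      Real.cos_add_nat_mul_two_pi]
  rw [this] at h1
  linarith

lemma f_int (H : ℝ) (hH0 : 0 < H) (hH1 : H < 1) (k : ℤ) :
    IntegrableOn (fun x => eK k x * ((2 * jH H 1 x : ℝ) : ℂ)) (Set.Ioi 0) := by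
  refine Integrable.bdd_mul (c := 1) ?_ (eK_cont k).aestronglyMeasurable ?_
  · exact ((jH_integrable H 1 hH0 hH1).const_mul 2).ofReal
  · exact Filter.Eventually.of_forall fun x => (eK_norm k x).le

lemma int_s (H : ℝ) (hH0 : 0 < H) (hH1 : H < 1) (k : ℤ) :
    ∫ t in Set.Ioo (0:ℝ) 1, eK k t * (sH H t : ℂ)
      = ∫ x in Set.Ioi (0:ℝ), eK k x * ((2 * jH H 1 x : ℝ) : ℂ) := by
  rw [← unfold_pos _ (f_int H hH0 hH1 k)]
  congr 1
  funext t
  have : ∀ n : ℕ, eK k (n + t) * ((2 * jH H 1 (n + t) : ℝ) : ℂ)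
      = eK k t * (((4 * Real.sin (Real.pi * t)^2) * ((n + t) ^ (-(2*H+1))) : ℝ) : ℂ) := by
    intro n
    rw [eK_add_nat, ← sin_add_nat n t, sin_eq]
    unfold jH
    congr 2
    ring
  simp only [this]
  rw [tsum_mul_left, ← Complex.ofReal_tsum, tsum_mul_left]
  rfl

lemma s_int (H : ℝ) (hH0 : 0 < H) (hH1 : H < 1) : IntegrableOn (sH H) (Set.Ioo 0 1) := by
  by_contra hn
  have h := int_s H hH0 hH1 0
  have e : ∀ x, eK 0 x = 1 := by intro x; simp [eK]
  simp only [e, one_mul] at h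
  rw [integral_complex_ofReal, integral_complex_ofReal, integral_const_mul] at h
  have h0 : ∫ t in Set.Ioo (0:ℝ) 1, sH H t = 0 := integral_undef hn
  have hp := jH_pos H hH0 hH1
  rw [h0] at h
  have h' := Complex.ofReal_injective h
  linarith

lemma es_int (H : ℝ) (hH0 : 0 < H) (hH1 : H < 1) (k : ℤ) :
    IntegrableOn (fun t => eK k t * (sH H t : ℂ)) (Set.Ioo 0 1) := by
  refine Integrable.bdd_mul (c := 1) ?_ (eK_cont k).aestronglyMeasurable ?_
  · exact (s_int H hH0 hH1).ofReal
  · exact Filter.Eventually.of_forall fun x => (eK_norm k x).le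

lemma refl_int {E : Type} [NormedAddCommGroup E] [NormedSpace ℝ E] (f : ℝ → E)
    (h : IntegrableOn f (Set.Ioo 0 1)) : IntegrableOn (fun t => f (1 - t)) (Set.Ioo 0 1) := by
  have h1 := (intervalIntegrable_iff_integrableOn_Ioo_of_le zero_le_one).2 h
  have h2 := (h1.comp_sub_left 1).symm
  simp only [sub_zero, sub_self] at h2
  exact (intervalIntegrable_iff_integrableOn_Ioo_of_le zero_le_one).1 h2

lemma refl_integral {E : Type} [NormedAddCommGroup E] [NormedSpace ℝ E] (f : ℝ → E) :
    ∫ t in Set.Ioo (0:ℝ) 1, f (1 - t) = ∫ t in Set.Ioo (0:ℝ) 1, f t := by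
  rw [← integral_Ioc_eq_integral_Ioo, ← integral_Ioc_eq_integral_Ioo,
    ← intervalIntegral.integral_of_le zero_le_one,
    ← intervalIntegral.integral_of_le zero_le_one, intervalIntegral.integral_comp_sub_left]
  simp

lemma eK_cos (k : ℤ) (x : ℝ) :
    eK k x + eK (-k) x = ((2 * Real.cos (2 * Real.pi * k * x) : ℝ) : ℂ) := by
  unfold eK
  push_cast
  rw [Complex.two_cos]
  congr 2
  ring

lemma main_int (H : ℝ) (hH0 : 0 < H) (hH1 : H < 1) (k : ℤ) :
    ∫ t in Set.Ioo (0:ℝ) 1, eK k t * (psi H t : ℂ)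
      = ((4 * (∫ x in Set.Ioi (0:ℝ), jH H 1 x) * gammaH H k : ℝ) : ℂ) := by
  have h1 : ∀ t, eK k t * (psi H t : ℂ)
      = eK k t * (sH H t : ℂ) + eK (-k) (1 - t) * (sH H (1 - t) : ℂ) := by
    intro t
    rw [eK_sub, neg_neg, psi_eq]; push_cast; ring
  simp only [h1]
  rw [integral_add (es_int H hH0 hH1 k)
    (refl_int (fun t => eK (-k) t * (sH H t : ℂ)) (es_int H hH0 hH1 (-k))),
    refl_integral (fun t => eK (-k) t * (sH H t : ℂ)), int_s H hH0 hH1, int_s H hH0 hH1,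
    ← integral_add (f_int H hH0 hH1 k) (f_int H hH0 hH1 (-k))]
  have h2 : ∀ x, eK k x * ((2 * jH H 1 x : ℝ) : ℂ) + eK (-k) x * ((2 * jH H 1 x : ℝ) : ℂ)
      = (((2 * jH H (k+1) x + 2 * jH H (k-1) x) - 4 * jH H k x : ℝ) : ℂ) := by
    intro x
    rw [← add_mul, eK_cos, ← Complex.ofReal_mul]
    congr 1
    unfold jH
    have e1 : Real.cos (2 * Real.pi * (k+1) * x) + Real.cos (2 * Real.pi * (k-1) * x)
        = 2 * Real.cos (2 * Real.pi * k * x) * Real.cos (2 * Real.pi * 1 * x) := by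
      rw [show 2 * Real.pi * (k+1) * x = 2 * Real.pi * k * x + 2 * Real.pi * 1 * x by ring,
        show 2 * Real.pi * (k-1) * x = 2 * Real.pi * k * x - 2 * Real.pi * 1 * x by ring,
        Real.cos_add, Real.cos_sub]
      ring
    linear_combination (-2 * x ^ (-(2*H+1))) * (-e1)
  simp only [h2]
  rw [integral_complex_ofReal]
  have i := fun c => jH_integrable H c hH0 hH1
  have i2 : Integrable (fun x => 2 * jH H (k+1) x + 2 * jH H (k-1) x)
      (volume.restrict (Set.Ioi 0)) := ((i _).const_mul 2).add ((i _).const_mul 2)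
  rw [integral_sub i2 ((i _).const_mul 4),
    integral_add ((i _).const_mul 2) ((i _).const_mul 2)]
  simp only [integral_const_mul]
  rw [jH_scale H (k+1) hH0, jH_scale H (k-1) hH0, jH_scale H k hH0]
  congr 1
  unfold gammaH
  push_cast
  ring

/-- For `0 < H < 1`, `ψ_H` is integrable on `(0,1)` and there is a
constant `C(H) > 0` such that `γ_H(k) = C(H) · ∫_0^1 e^{2πikt} ψ_H(t) dt` for every
`k ∈ ℤ`; i.e. up to normalization, `ψ_H` is the spectral density of fractional
Gaussian noise of Hurst index `H`. -/
theorem stmt16 (H : ℝ) (hH0 : 0 < H) (hH1 : H < 1) :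
    IntegrableOn (psi H) (Set.Ioo (0 : ℝ) 1) ∧
    ∃ C : ℝ, 0 < C ∧ ∀ k : ℤ,
      (gammaH H k : ℂ) = (C : ℂ) *
        ∫ t in Set.Ioo (0 : ℝ) 1,
          Complex.exp (2 * Real.pi * (k : ℝ) * t * Complex.I) * (psi H t : ℂ) := by
  constructor
  · have : psi H = fun t => sH H t + sH H (1 - t) := funext (psi_eq H)
    rw [this]
    exact (s_int H hH0 hH1).add (refl_int _ (s_int H hH0 hH1))
  · have hp := jH_pos H hH0 hH1
    refine ⟨(4 * ∫ x in Set.Ioi (0:ℝ), jH H 1 x)⁻¹, by positivity, fun k => ?_⟩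
    have h := main_int H hH0 hH1 k
    unfold eK at h
    rw [h, ← Complex.ofReal_mul]
    congr 1
    field_simp
end
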